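/- arXiv:2511.09673 — 2 statements merged into one kernel-verified Lean document; each statement's English description precedes it below -/
import Mathlib

section
/- Let S be a 1-separated subset of the unit sphere S_X of the Petty space, and set D₂ = {(x,y,z) ∈ S_X : 1/3 < z ≤ 1/2}, D₃ = {(x,y,z) ∈ S_X : 1/4 < z ≤ 1/3} and D₅ = {(x,y,z) ∈ S_X : 0.224 < z ≤ 1/3}. If S ∩ D₃ has at least 1 element and S ∩ D₅ has at least 2 elements, then S ∩ D₂ has at most 2 elements. -/
/-- The Petty norm on ℝ³: ‖(x,y,z)‖ = √(x²+y²) + |z|. -/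
noncomputable def pettyNorm (a : ℝ × ℝ × ℝ) : ℝ :=
  Real.sqrt (a.1 ^ 2 + a.2.1 ^ 2) + |a.2.2|

/-- The Petty distance on ℝ³. -/
noncomputable def pettyDist (a b : ℝ × ℝ × ℝ) : ℝ := pettyNorm (a - b)

/-- The unit sphere of the Petty space. -/
def pettySphere : Set (ℝ × ℝ × ℝ) := {a | pettyNorm a = 1}

/-- A set is 1-separated if all pairwise Petty distances are ≥ 1. -/
def OneSeparated (S : Set (ℝ × ℝ × ℝ)) : Prop :=
  ∀ a ∈ S, ∀ b ∈ S, a ≠ b → 1 ≤ pettyDist a b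

open Real in
/-- A point of the upper half of the Petty sphere has cylindrical coordinates with angle in
`[φ, φ + 2π)`. -/
theorem exists_angle_of_mem_pettySphere {a : ℝ × ℝ × ℝ} (ha : a ∈ pettySphere) (hz : 0 ≤ a.2.2)
    (φ : ℝ) : ∃ θ, φ ≤ θ ∧ θ < φ + 2 * π ∧
      a.1 = (1 - a.2.2) * cos θ ∧ a.2.1 = (1 - a.2.2) * sin θ := by
  have hr : √(a.1 ^ 2 + a.2.1 ^ 2) = 1 - a.2.2 := by
    have h : √(a.1 ^ 2 + a.2.1 ^ 2) + |a.2.2| = 1 := ha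
    rw [abs_of_nonneg hz] at h
    linarith
  have hn : ‖(⟨a.1, a.2.1⟩ : ℂ)‖ = 1 - a.2.2 := by
    rw [Complex.norm_eq_sqrt_sq_add_sq, hr]
  have hmem := toIcoMod_mem_Ico two_pi_pos φ (Complex.arg ⟨a.1, a.2.1⟩)
  refine ⟨toIcoMod two_pi_pos φ (Complex.arg ⟨a.1, a.2.1⟩), hmem.1, hmem.2, ?_, ?_⟩
  · rw [toIcoMod, zsmul_eq_mul, cos_sub_int_mul_two_pi, ← hn, Complex.norm_mul_cos_arg]
  · rw [toIcoMod, zsmul_eq_mul, sin_sub_int_mul_two_pi, ← hn, Complex.norm_mul_sin_arg]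

open Real in
/-- The angular form of 1-separation for two points given in cylindrical coordinates. -/
theorem le_one_sub_cos_of_one_le_pettyDist {a b : ℝ × ℝ × ℝ} {θ η : ℝ}
    (ha1 : a.1 = (1 - a.2.2) * cos θ) (ha2 : a.2.1 = (1 - a.2.2) * sin θ)
    (hb1 : b.1 = (1 - b.2.2) * cos η) (hb2 : b.2.1 = (1 - b.2.2) * sin η)
    (hz : |a.2.2 - b.2.2| ≤ 1) (h : 1 ≤ pettyDist a b) :
    1 - 2 * |a.2.2 - b.2.2| ≤ 2 * ((1 - a.2.2) * (1 - b.2.2)) * (1 - cos (θ - η)) := by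
  have h' : 1 ≤ √((a.1 - b.1) ^ 2 + (a.2.1 - b.2.1) ^ 2) + |a.2.2 - b.2.2| := h
  have hsq : (1 - |a.2.2 - b.2.2|) ^ 2 ≤ (a.1 - b.1) ^ 2 + (a.2.1 - b.2.1) ^ 2 :=
    (le_sqrt (by linarith) (by positivity)).1 (by linarith)
  have hexp : (a.1 - b.1) ^ 2 + (a.2.1 - b.2.1) ^ 2 =
      (a.2.2 - b.2.2) ^ 2 + 2 * ((1 - a.2.2) * (1 - b.2.2)) * (1 - cos (θ - η)) := by
    rw [ha1, ha2, hb1, hb2, cos_sub]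
    linear_combination (1 - a.2.2) ^ 2 * sin_sq_add_cos_sq θ +
      (1 - b.2.2) ^ 2 * sin_sq_add_cos_sq η
  rw [hexp, ← sq_abs (a.2.2 - b.2.2)] at hsq
  linarith

open Real in
theorem le_abs_of_cos_le_cos {x α : ℝ} (hα : α ≤ π) (h : cos x ≤ cos α) :
    α ≤ |x| := by
  by_contra! hx
  have := cos_lt_cos_of_nonneg_of_le_pi (abs_nonneg x) hα hx
  rw [cos_abs] at this
  linarith

open Real in
theorem abs_le_two_pi_sub_of_cos_le_cos {x α : ℝ} (hα : α ≤ π) (hx : |x| ≤ 2 * π)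
    (h : cos x ≤ cos α) : |x| ≤ 2 * π - α := by
  have := le_abs_of_cos_le_cos (x := 2 * π - |x|) hα (by rwa [cos_two_pi_sub, cos_abs])
  rw [abs_of_nonneg (by linarith)] at this
  linarith

open Real in
/-- Two points at distance at least `1` differ in angle by at least `arccos (1 - k)`, provided that
`k` is a lower bound for `1 - cos` at their heights. -/
theorem angle_bounds_of_one_le_pettyDist {a b : ℝ × ℝ × ℝ} {θ η k : ℝ}
    (ha1 : a.1 = (1 - a.2.2) * cos θ) (ha2 : a.2.1 = (1 - a.2.2) * sin θ)
    (hb1 : b.1 = (1 - b.2.2) * cos η) (hb2 : b.2.1 = (1 - b.2.2) * sin η)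
    (ha : a.2.2 ∈ Set.Ico 0 1) (hb : b.2.2 ∈ Set.Ico 0 1) (hθη : |θ - η| ≤ 2 * π)
    (h : 1 ≤ pettyDist a b) (hk0 : 0 ≤ k) (hk2 : k ≤ 2)
    (hk : 2 * ((1 - a.2.2) * (1 - b.2.2)) * k ≤ 1 - 2 * |a.2.2 - b.2.2|) :
    arccos (1 - k) ≤ |θ - η| ∧ |θ - η| ≤ 2 * π - arccos (1 - k) := by
  obtain ⟨ha0, ha1'⟩ := ha
  obtain ⟨hb0, hb1'⟩ := hb
  have hpos : 0 < 2 * ((1 - a.2.2) * (1 - b.2.2)) :=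
    mul_pos two_pos (mul_pos (sub_pos.2 ha1') (sub_pos.2 hb1'))
  have hz : |a.2.2 - b.2.2| ≤ 1 := abs_le.2 ⟨by linarith, by linarith⟩
  have hdist := le_one_sub_cos_of_one_le_pettyDist ha1 ha2 hb1 hb2 hz h
  have hcos : cos (θ - η) ≤ cos (arccos (1 - k)) := by
    rw [cos_arccos (by linarith) (by linarith)]
    linarith [le_of_mul_le_mul_left (hk.trans hdist) hpos]
  exact ⟨le_abs_of_cos_le_cos (arccos_le_pi _) hcos,
    abs_le_two_pi_sub_of_cos_le_cos (arccos_le_pi _) hθη hcos⟩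

theorem height_bound_of_one_third_le {z w : ℝ} (hz : 1 / 3 ≤ z) (hz' : z ≤ 1 / 2)
    (hw : 1 / 3 ≤ w) (hw' : w ≤ 1 / 2) :
    2 * ((1 - z) * (1 - w)) * 1 ≤ 1 - 2 * |z - w| := by
  rcases abs_cases (z - w) with ⟨h, _⟩ | ⟨h, _⟩ <;> rw [h] <;>
    nlinarith [mul_nonneg (sub_nonneg.2 hz) (sub_nonneg.2 hw'),
      mul_nonneg (sub_nonneg.2 hw) (sub_nonneg.2 hz')]

theorem height_bound_upper {z w : ℝ} (hz : 1 / 3 ≤ z) (hz' : z ≤ 1 / 2)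
    (hw : 1 / 4 ≤ w) (hw' : w ≤ 1 / 3) :
    2 * ((1 - z) * (1 - w)) * (2 / 3) ≤ 1 - 2 * |z - w| := by
  rw [abs_of_nonneg (by linarith)]
  nlinarith [mul_nonneg (sub_nonneg.2 hw) (sub_nonneg.2 hz')]

theorem height_bound_lower {z w : ℝ} (hz : 0.224 ≤ z) (hz' : z ≤ 1 / 3)
    (hw : 1 / 3 ≤ w) (hw' : w ≤ 1 / 2) :
    2 * ((1 - z) * (1 - w)) * 0.577 ≤ 1 - 2 * |z - w| := by
  rw [abs_sub_comm, abs_of_nonneg (by linarith)]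
  nlinarith [mul_nonneg (sub_nonneg.2 hz) (sub_nonneg.2 hw')]

theorem height_bound_lower_lower {z w : ℝ} (hz : 0.224 ≤ z) (hz' : z ≤ 1 / 3)
    (hw : 0.224 ≤ w) (hw' : w ≤ 1 / 3) :
    2 * ((1 - z) * (1 - w)) * 0.577 ≤ 1 - 2 * |z - w| := by
  rcases abs_cases (z - w) with ⟨h, _⟩ | ⟨h, _⟩ <;> rw [h] <;>
    nlinarith [mul_nonneg (sub_nonneg.2 hz) (sub_nonneg.2 hw'),
      mul_nonneg (sub_nonneg.2 hw) (sub_nonneg.2 hz')]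

open Real in
theorem three_pi_div_four_lt_arccos_add_arccos :
    3 * π / 4 < arccos (1 - 2 / 3) + arccos (1 - 0.577) := by
  have h1 : arccos (1 - 2 / 3) ≤ π / 2 := arccos_le_pi_div_two.2 (by norm_num)
  have h2 : arccos (1 - 0.577) ≤ π / 2 := arccos_le_pi_div_two.2 (by norm_num)
  by_contra! hle
  have hcos := cos_le_cos_of_nonneg_of_le_pi
    (add_nonneg (arccos_nonneg (1 - 2 / 3)) (arccos_nonneg (1 - 0.577)))
    (by linarith [pi_pos]) hle
  have h34 : cos (3 * π / 4) = -(√2 / 2) := by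
    rw [show 3 * π / 4 = π - π / 4 by ring, cos_pi_sub, cos_pi_div_four]
  rw [h34, cos_add, cos_arccos (by norm_num) (by norm_num), cos_arccos (by norm_num) (by norm_num),
    sin_arccos, sin_arccos] at hcos
  have hs : √2 < 1.415 := (sqrt_lt' (by norm_num)).2 (by norm_num)
  have ha : 0.942 ≤ √(1 - (1 - 2 / 3 : ℝ) ^ 2) := le_sqrt_of_sq_le (by norm_num)
  have hb : 0.906 ≤ √(1 - (1 - 0.577 : ℝ) ^ 2) := le_sqrt_of_sq_le (by norm_num)
  have hab := mul_le_mul ha hb (by norm_num) (sqrt_nonneg _)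
  norm_num at hcos hab hs
  linarith

open Real in
theorem pi_div_three_le_arccos : π / 3 ≤ arccos (1 - 0.577) := by
  rw [← arccos_cos (by positivity) (by linarith [pi_pos] : π / 3 ≤ π), cos_pi_div_three]
  exact arccos_le_arccos (by norm_num)

/-- Five angles, three of them (`u`, `v`, `w`) pairwise at least a quarter turn apart, cannot fit
around a circle when the separations from the remaining two (`0` and `t`) are too large. -/
theorem false_of_angle_separation {π α β t u v w : ℝ}
    (hαβ : 3 * π / 4 < α + β) (hβ : π / 3 ≤ β)
    (ht : β ≤ |t| ∧ |t| ≤ 2 * π - β) (ht0 : 0 ≤ t) (hu0 : 0 ≤ u) (hv0 : 0 ≤ v) (hw0 : 0 ≤ w)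
    (hu : α ≤ |u| ∧ |u| ≤ 2 * π - α) (hv : α ≤ |v| ∧ |v| ≤ 2 * π - α)
    (hw : α ≤ |w| ∧ |w| ≤ 2 * π - α)
    (huv : π / 2 ≤ |u - v|) (hvw : π / 2 ≤ |v - w|) (huw : π / 2 ≤ |u - w|)
    (htu : β ≤ |t - u|) (htv : β ≤ |t - v|) (htw : β ≤ |t - w|) (hπ : 0 < π) : False := by
  wlog h1 : u ≤ v generalizing u v w
  · exact this hv0 hu0 hw0 hv hu hw (abs_sub_comm u v ▸ huv) huw hvw htv htu htw (by linarith)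
  wlog h2 : v ≤ w generalizing u v w
  · rcases le_total u w with h | h
    · exact this hu0 hw0 hv0 hu hw hv huw (abs_sub_comm v w ▸ hvw) huv htu htw htv h (by linarith)
    · exact this hw0 hu0 hv0 hw hu hv (abs_sub_comm u w ▸ huw) huv (abs_sub_comm v w ▸ hvw)
        htw htu htv h h1
  rw [abs_of_nonneg ht0] at ht
  rw [abs_of_nonneg hu0] at hu
  rw [abs_of_nonneg hw0] at hw
  rw [abs_sub_comm, abs_of_nonneg (by linarith)] at huv hvw
  rcases le_abs'.1 htu with h3 | h3 <;> rcases le_abs'.1 htv with h4 | h4 <;>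
    rcases le_abs'.1 htw with h5 | h5 <;> linarith

/-- for a 1-separated subset S of the Petty unit sphere,
if |S ∩ D₃| ≥ 1 and |S ∩ D₅| ≥ 2 then |S ∩ D₂| ≤ 2. -/
theorem oneSeparated_D3_D5_D2 (S : Set (ℝ × ℝ × ℝ)) (hsep : OneSeparated S)
    (hS : S ⊆ pettySphere)
    (h3 : 1 ≤ (S ∩ {a ∈ pettySphere | 1/4 < a.2.2 ∧ a.2.2 ≤ 1/3}).encard)
    (h5 : 2 ≤ (S ∩ {a ∈ pettySphere | 0.224 < a.2.2 ∧ a.2.2 ≤ 1/3}).encard) :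
    (S ∩ {a ∈ pettySphere | 1/3 < a.2.2 ∧ a.2.2 ≤ 1/2}).encard ≤ 2 := by
  have hdist : ∀ {a b : ℝ × ℝ × ℝ}, a ∈ S → b ∈ S → a.2.2 ≠ b.2.2 → 1 ≤ pettyDist a b :=
    fun ha hb hab => hsep _ ha _ hb fun h => hab (h ▸ rfl)
  obtain ⟨s, hsS, hs, hs1, hs2⟩ := Set.one_le_encard_iff_nonempty.1 h3
  obtain ⟨t, ⟨htS, ht, ht1, ht2⟩, hts⟩ := Set.exists_ne_of_one_lt_encard
    (lt_of_lt_of_le (by norm_num) h5) s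
  by_contra! hcard
  obtain ⟨T, hT, hT3⟩ := Set.exists_subset_encard_eq (k := 3) (Order.add_one_le_of_lt hcard)
  obtain ⟨u, v, w, huv, huw, hvw, rfl⟩ := Set.encard_eq_three.1 hT3
  obtain ⟨huS, hu, hu1, hu2⟩ := hT (by simp : u ∈ _)
  obtain ⟨hvS, hv, hv1, hv2⟩ := hT (by simp : v ∈ _)
  obtain ⟨hwS, hw, hw1, hw2⟩ := hT (by simp : w ∈ _)
  obtain ⟨φ, -, -, hsx, hsy⟩ := exists_angle_of_mem_pettySphere hs (by linarith) 0
  obtain ⟨θt, ht0, htπ, htx, hty⟩ := exists_angle_of_mem_pettySphere ht (by linarith) φ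
  obtain ⟨θu, hu0, huπ, hux, huy⟩ := exists_angle_of_mem_pettySphere hu (by linarith) φ
  obtain ⟨θv, hv0, hvπ, hvx, hvy⟩ := exists_angle_of_mem_pettySphere hv (by linarith) φ
  obtain ⟨θw, hw0, hwπ, hwx, hwy⟩ := exists_angle_of_mem_pettySphere hw (by linarith) φ
  have bound_s : ∀ z : ℝ, 1 / 3 < z → z ≤ 1 / 2 →
      2 * ((1 - z) * (1 - s.2.2)) * (2 / 3) ≤ 1 - 2 * |z - s.2.2| :=
    fun z hz hz' => height_bound_upper hz.le hz' hs1.le hs2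
  have bound_t : ∀ z : ℝ, 1 / 3 < z → z ≤ 1 / 2 →
      2 * ((1 - t.2.2) * (1 - z)) * 0.577 ≤ 1 - 2 * |t.2.2 - z| :=
    fun z hz hz' => height_bound_lower ht1.le ht2 hz.le hz'
  have hd : ∀ {x y : ℝ}, φ ≤ x → x < φ + 2 * Real.pi → φ ≤ y → y < φ + 2 * Real.pi →
      |x - y| ≤ 2 * Real.pi :=
    fun _ _ _ _ => abs_le.2 ⟨by linarith, by linarith⟩
  have hφ : φ < φ + 2 * Real.pi := by linarith [Real.pi_pos]
  have hs' : s.2.2 ∈ Set.Ico (0 : ℝ) 1 := ⟨by linarith, by linarith⟩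
  have ht' : t.2.2 ∈ Set.Ico (0 : ℝ) 1 := ⟨by linarith, by linarith⟩
  have hu' : u.2.2 ∈ Set.Ico (0 : ℝ) 1 := ⟨by linarith, by linarith⟩
  have hv' : v.2.2 ∈ Set.Ico (0 : ℝ) 1 := ⟨by linarith, by linarith⟩
  have hw' : w.2.2 ∈ Set.Ico (0 : ℝ) 1 := ⟨by linarith, by linarith⟩
  have bts := angle_bounds_of_one_le_pettyDist htx hty hsx hsy ht' hs' (hd ht0 htπ le_rfl hφ)
    (hsep t htS s hsS hts) (by norm_num) (by norm_num)
    (height_bound_lower_lower ht1.le ht2 (by linarith) hs2)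
  have bus := angle_bounds_of_one_le_pettyDist hux huy hsx hsy hu' hs' (hd hu0 huπ le_rfl hφ)
    (hdist huS hsS (by linarith)) (by norm_num) (by norm_num) (bound_s _ hu1 hu2)
  have bvs := angle_bounds_of_one_le_pettyDist hvx hvy hsx hsy hv' hs' (hd hv0 hvπ le_rfl hφ)
    (hdist hvS hsS (by linarith)) (by norm_num) (by norm_num) (bound_s _ hv1 hv2)
  have bws := angle_bounds_of_one_le_pettyDist hwx hwy hsx hsy hw' hs' (hd hw0 hwπ le_rfl hφ)
    (hdist hwS hsS (by linarith)) (by norm_num) (by norm_num) (bound_s _ hw1 hw2)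
  have btu := angle_bounds_of_one_le_pettyDist htx hty hux huy ht' hu' (hd ht0 htπ hu0 huπ)
    (hdist htS huS (by linarith)) (by norm_num) (by norm_num) (bound_t _ hu1 hu2)
  have btv := angle_bounds_of_one_le_pettyDist htx hty hvx hvy ht' hv' (hd ht0 htπ hv0 hvπ)
    (hdist htS hvS (by linarith)) (by norm_num) (by norm_num) (bound_t _ hv1 hv2)
  have btw := angle_bounds_of_one_le_pettyDist htx hty hwx hwy ht' hw' (hd ht0 htπ hw0 hwπ)
    (hdist htS hwS (by linarith)) (by norm_num) (by norm_num) (bound_t _ hw1 hw2)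
  have buv := angle_bounds_of_one_le_pettyDist hux huy hvx hvy hu' hv' (hd hu0 huπ hv0 hvπ)
    (hsep u huS v hvS huv) zero_le_one one_le_two
    (height_bound_of_one_third_le hu1.le hu2 hv1.le hv2)
  have bvw := angle_bounds_of_one_le_pettyDist hvx hvy hwx hwy hv' hw' (hd hv0 hvπ hw0 hwπ)
    (hsep v hvS w hwS hvw) zero_le_one one_le_two
    (height_bound_of_one_third_le hv1.le hv2 hw1.le hw2)
  have buw := angle_bounds_of_one_le_pettyDist hux huy hwx hwy hu' hw' (hd hu0 huπ hw0 hwπ)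
    (hsep u huS w hwS huw) zero_le_one one_le_two
    (height_bound_of_one_third_le hu1.le hu2 hw1.le hw2)
  rw [sub_self, Real.arccos_zero] at buv bvw buw
  refine false_of_angle_separation three_pi_div_four_lt_arccos_add_arccos pi_div_three_le_arccos
    bts (sub_nonneg.2 ht0) (sub_nonneg.2 hu0) (sub_nonneg.2 hv0) (sub_nonneg.2 hw0) bus bvs bws
    ?_ ?_ ?_ ?_ ?_ ?_ Real.pi_pos <;> rw [sub_sub_sub_cancel_right]
  exacts [buv.1, bvw.1, buw.1, btu.1, btv.1, btw.1]
end

section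
/- Every 1-separated subset of the unit sphere S_X of the Petty space has at most 16 elements; in particular, the Hadwiger number H(X) of the Petty space satisfies H(X) ≤ 16. -/
/-- Lower bounds, in degrees, for the angle between the horizontal parts of two `1`-separated points
of the unit sphere. The point with horizontal radius `r` and class `k` (see `radiusBreaks`) has
index `2 * k` if it lies in the upper half-space and `2 * k + 1` otherwise. -/
def angleTable : List (List ℕ) :=
  [[113, 0, 89, 0, 66, 0, 53, 0, 36, 0, 0, 0],
   [0, 113, 0, 89, 0, 66, 0, 53, 0, 36, 0, 0],
   [89, 0, 94, 17, 72, 22, 61, 26, 48, 28, 31, 30],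
   [0, 89, 17, 94, 22, 72, 26, 61, 28, 48, 30, 31],
   [66, 0, 72, 22, 76, 28, 66, 34, 54, 36, 41, 39],
   [0, 66, 22, 72, 28, 76, 34, 66, 36, 54, 39, 41],
   [53, 0, 61, 26, 66, 34, 71, 40, 60, 43, 49, 46],
   [0, 53, 26, 61, 34, 66, 40, 71, 43, 60, 46, 49],
   [36, 0, 48, 28, 54, 36, 60, 43, 63, 47, 53, 50],
   [0, 36, 28, 48, 36, 54, 43, 60, 47, 63, 50, 53],
   [0, 0, 31, 30, 41, 39, 49, 46, 53, 50, 56, 53],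
   [0, 0, 30, 31, 39, 41, 46, 49, 50, 53, 53, 56]]

/-- The angle bound of `angleTable` for points of index `a` and `b`. -/
def minAngle (a b : ℕ) : ℕ := (angleTable.getD a []).getD b 0

/-- A point of horizontal radius `r` has class `k` when `1 - 1 / (2 * r)` lies between the `k`-th
and the `(k + 1)`-st of these numbers, divided by `20`. -/
def radiusBreaks (k : ℕ) : ℚ := ([0, 3, 5, 7, 8, 9, 10] : List ℚ).getD k 0 / 20

/-- Passes to `k` the pointwise maximum of the first list and the second one shifted by `p`. The
pattern matching on the maximum makes the kernel evaluate it at once. -/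
def withMax (p : ℕ) : List ℕ → List ℕ → (List ℕ → Bool) → Bool
  | q :: l, d :: l', k => withMax p l l' fun m =>
      match q + (p + d - q) with
      | 0 => k (0 :: m)
      | n + 1 => k ((n + 1) :: m)
  | _, _, k => k []

/-- Exhaustive search for sequences of indices that can be placed at positions which respect
`minAngle` and in which the `j`-th position is at most `24 * j`. The next point has to be placed
before `b`, and a point of index `a` has to be placed beyond the `a`-th entry of the list. The
result `true` means that no sequence can be continued for `f` steps. -/
def noPlacement : ℕ → ℕ → List ℕ → Bool
  | 0, _, _ => false
  | f + 1, b, need => (need.zip angleTable).all fun r =>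
      Nat.blt b r.1 || withMax r.1 need r.2 (noPlacement f (b + 24))

theorem noPlacement_replicate : noPlacement 17 0 (List.replicate 12 0) = true := by
  decide +kernel

theorem withMax_eq (p : ℕ) (l l' : List ℕ) (k : List ℕ → Bool) :
    withMax p l l' k = k (List.zipWith (fun q d => max q (p + d)) l l') := by
  induction l generalizing l' k with
  | nil => simp [withMax]
  | cons q l ih =>
    cases l' with
    | nil => simp [withMax]
    | cons d l' =>
      have h : q + (p + d - q) = max q (p + d) := by omega
      simp only [withMax, ih, List.zipWith_cons_cons, h]
      cases max q (p + d) <;> rfl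

theorem not_noPlacement (s : ℕ → ℕ) (t : ℕ → ℝ) (hs : ∀ j, s j < 12)
    (hsep : ∀ i j, i < j → t i + minAngle (s i) (s j) ≤ t j) (ht : ∀ j, t j ≤ 24 * j)
    (f m : ℕ) (need : List ℕ) (hlen : need.length = 12)
    (hneed : ∀ j, m ≤ j → (need.getD (s j) 0 : ℝ) ≤ t j) :
    noPlacement f (24 * m) need = false := by
  induction f generalizing m need with
  | zero => rfl
  | succ f ih =>
    have htab : angleTable.length = 12 := rfl
    have hrow : ∀ a < 12, (angleTable.getD a []).length = 12 := by decide
    by_contra hcon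
    rw [Bool.not_eq_false, noPlacement, List.all_eq_true] at hcon
    have hmem : (need.getD (s m) 0, angleTable.getD (s m) []) ∈ need.zip angleTable := by
      have h1 : s m < need.length := hlen ▸ hs m
      have h2 : s m < angleTable.length := htab ▸ hs m
      rw [List.getD_eq_getElem _ _ h1, List.getD_eq_getElem _ _ h2, ← List.getElem_zip]
      · exact List.getElem_mem _
      · simp [h1, h2]
    have hm := hcon _ hmem
    have hle : need.getD (s m) 0 ≤ 24 * m := by
      exact_mod_cast (hneed m le_rfl).trans (ht m)
    have hblt : Nat.blt (24 * m) (need.getD (s m) 0) = false := by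
      refine Bool.eq_false_iff.2 fun h => ?_
      have := Nat.le_of_ble_eq_true h
      omega
    rw [Bool.or_eq_true, hblt, withMax_eq] at hm
    have hm := hm.resolve_left (by simp)
    rw [← mul_add_one, ih (m + 1) _ (by
      rw [List.length_zipWith, hlen, hrow _ (hs m), min_self])] at hm
    · simp at hm
    · intro j hj
      have h1 : s j < need.length := hlen ▸ hs j
      have h2 : s j < (angleTable.getD (s m) []).length := (hrow _ (hs m)).symm ▸ hs j
      rw [List.getD_eq_getElem _ _ (by simpa using ⟨h1, h2⟩), List.getElem_zipWith,
        ← List.getD_eq_getElem _ 0 h1, ← List.getD_eq_getElem _ 0 h2]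
      push_cast
      have h3 := hsep m j hj
      rw [minAngle] at h3
      exact max_le (hneed j (by omega)) ((add_le_add_left (hneed m le_rfl) _).trans h3)

/-- A lower bound for the cosine: `1 - x ^ 2 / 2` at `x / 2 ^ n`, followed by `n` doublings. -/
def cosLower : ℕ → ℚ → ℚ
  | 0, x => 1 - x ^ 2 / 2
  | n + 1, x => 2 * (max 0 (cosLower n (x / 2))) ^ 2 - 1

theorem cosLower_le_cos (n : ℕ) (x : ℚ) : (cosLower n x : ℝ) ≤ Real.cos x := by
  induction n generalizing x with
  | zero => simpa [cosLower] using Real.one_sub_sq_div_two_le_cos (x := (x : ℝ))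
  | succ n ih =>
    have hx := ih (x / 2)
    have hcos : Real.cos x = 2 * Real.cos ((x / 2 : ℚ) : ℝ) ^ 2 - 1 := by
      rw [← Real.cos_two_mul]
      push_cast
      ring_nf
    rw [hcos, cosLower]
    generalize Real.cos ((x / 2 : ℚ) : ℝ) = C at *
    push_cast
    rcases le_total (cosLower n (x / 2)) 0 with h | h
    · rw [max_eq_left (by exact_mod_cast h)]
      nlinarith [sq_nonneg C]
    · have h0 : (0 : ℝ) ≤ cosLower n (x / 2) := by exact_mod_cast h
      rw [max_eq_right h0]
      nlinarith

/-- `d` degrees is at most the angle whose half has squared sine `v`. -/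
def angleCheck (d : ℕ) (v : ℚ) : Bool :=
  decide (d = 0 ∨ d ≤ 120 ∧ 1 - 2 * v ≤ cosLower 6 (d * (31416 / 10000) / 180))

theorem degree_le_of_angleCheck {d : ℕ} {v : ℚ} (h : angleCheck d v = true) {δ : ℝ} (hδ : 0 ≤ δ)
    (hcos : Real.cos δ ≤ 1 - 2 * v) : d * (Real.pi / 180) ≤ δ := by
  rcases of_decide_eq_true h with rfl | ⟨hd, hv⟩
  · simpa using hδ
  · by_contra! hlt
    have hd' : (d : ℝ) ≤ 120 := by exact_mod_cast hd
    have hd0 : (0 : ℝ) ≤ d := d.cast_nonneg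
    have hpi := Real.pi_lt_d4
    have hpi' := Real.pi_gt_three
    have h1 : δ < d * (31416 / 10000) / 180 := by nlinarith
    have h2 : (d : ℝ) * (31416 / 10000) / 180 ≤ Real.pi := by nlinarith
    have h3 := Real.cos_lt_cos_of_nonneg_of_le_pi hδ h2 h1
    have h4 := cosLower_le_cos 6 (d * (31416 / 10000) / 180)
    have h5 : ((1 - 2 * v : ℚ) : ℝ) ≤ cosLower 6 (d * (31416 / 10000) / 180) := by
      exact_mod_cast hv
    push_cast at h4 h5
    linarith

theorem angleCheck_opposite_side : ∀ k < 6, ∀ l < 6, ∀ i < 2, ∀ j < 2, i ≠ j →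
    angleCheck (minAngle (2 * k + i) (2 * l + j)) (radiusBreaks k * radiusBreaks l) = true := by
  decide +kernel

theorem angleCheck_same_side : ∀ k < 6, ∀ l < 6, ∀ i < 2,
    angleCheck (minAngle (2 * k + i) (2 * l + i))
      (1 - radiusBreaks (k + 1) * (2 - radiusBreaks l)) = true ∧
    angleCheck (minAngle (2 * k + i) (2 * l + i))
      (1 - radiusBreaks (l + 1) * (2 - radiusBreaks k)) = true := by
  decide +kernel

/-- The distance of a point from the vertical axis. -/
noncomputable def horizontalRadius (p : ℝ × ℝ × ℝ) : ℝ := Real.sqrt (p.1 ^ 2 + p.2.1 ^ 2)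

/-- The polar angle of the horizontal part of a point. -/
noncomputable def horizontalArg (p : ℝ × ℝ × ℝ) : ℝ := Complex.arg ⟨p.1, p.2.1⟩

theorem horizontalRadius_sub_sq (p q : ℝ × ℝ × ℝ) :
    horizontalRadius (p - q) ^ 2 = horizontalRadius p ^ 2 + horizontalRadius q ^ 2 -
      2 * horizontalRadius p * horizontalRadius q *
        Real.cos (horizontalArg p - horizontalArg q) := by
  have polar : ∀ a : ℝ × ℝ × ℝ, horizontalRadius a * Real.cos (horizontalArg a) = a.1 ∧
      horizontalRadius a * Real.sin (horizontalArg a) = a.2.1 := by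
    intro a
    have hnorm : horizontalRadius a = ‖(⟨a.1, a.2.1⟩ : ℂ)‖ := by
      rw [Complex.norm_eq_sqrt_sq_add_sq, horizontalRadius]
    rw [hnorm]
    exact ⟨Complex.norm_mul_cos_arg _, Complex.norm_mul_sin_arg _⟩
  have sq : ∀ a : ℝ × ℝ × ℝ, horizontalRadius a ^ 2 = a.1 ^ 2 + a.2.1 ^ 2 := fun a =>
    Real.sq_sqrt (by positivity)
  obtain ⟨hp1, hp2⟩ := polar p
  obtain ⟨hq1, hq2⟩ := polar q
  have hmul : horizontalRadius p * horizontalRadius q *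
      Real.cos (horizontalArg p - horizontalArg q) = p.1 * q.1 + p.2.1 * q.2.1 := by
    rw [Real.cos_sub, ← hp1, ← hq1, ← hp2, ← hq2]
    ring
  have h := sq (p - q)
  simp only [Prod.fst_sub, Prod.snd_sub] at h
  rw [h, sq p, sq q]
  linarith

theorem horizontalRadius_add_abs {p : ℝ × ℝ × ℝ} (hp : p ∈ pettySphere) :
    horizontalRadius p + |p.2.2| = 1 := hp

theorem cos_le_of_one_le_pettyDist {p q : ℝ × ℝ × ℝ} (hp : p ∈ pettySphere) (hq : q ∈ pettySphere)
    (hpq : 1 ≤ pettyDist p q) (hrp : 1 / 2 ≤ horizontalRadius p)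
    (hrq : 1 / 2 ≤ horizontalRadius q) :
    Real.cos (horizontalArg p - horizontalArg q) ≤
      1 - 2 * ((1 - 1 / (2 * horizontalRadius p)) * (1 - 1 / (2 * horizontalRadius q))) := by
  have hp1 := horizontalRadius_add_abs hp
  have hq1 := horizontalRadius_add_abs hq
  have hsq := horizontalRadius_sub_sq p q
  have hd : 1 ≤ horizontalRadius (p - q) + |p.2.2 - q.2.2| := hpq
  have hz : |p.2.2 - q.2.2| ≤ |p.2.2| + |q.2.2| := abs_sub _ _
  generalize Real.cos (horizontalArg p - horizontalArg q) = C at *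
  generalize horizontalRadius (p - q) = D at *
  generalize horizontalRadius p = r at *
  generalize horizontalRadius q = s at *
  have hD : r + s - 1 ≤ D := by linarith
  have hD2 : (r + s - 1) ^ 2 ≤ D ^ 2 := pow_le_pow_left₀ (by linarith) hD 2
  have hr : 0 < r := by linarith
  have hs : 0 < s := by linarith
  have heq : 1 - 2 * ((1 - 1 / (2 * r)) * (1 - 1 / (2 * s))) =
      (2 * r * s - (2 * r - 1) * (2 * s - 1)) / (2 * r * s) := by
    field_simp
  rw [heq, le_div_iff₀ (by positivity)]
  nlinarith

theorem cos_le_of_same_side {p q : ℝ × ℝ × ℝ} (hp : p ∈ pettySphere) (hq : q ∈ pettySphere)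
    (hpq : 1 ≤ pettyDist p q) (hrp : 1 / 2 ≤ horizontalRadius p)
    (hrq : 1 / 2 ≤ horizontalRadius q) (hside : 0 ≤ p.2.2 ↔ 0 ≤ q.2.2)
    (hle : horizontalRadius q ≤ horizontalRadius p) :
    Real.cos (horizontalArg p - horizontalArg q) ≤
      1 - 2 * (1 - (1 - 1 / (2 * horizontalRadius p)) *
        (2 - (1 - 1 / (2 * horizontalRadius q)))) := by
  have hp1 := horizontalRadius_add_abs hp
  have hq1 := horizontalRadius_add_abs hq
  have hsq := horizontalRadius_sub_sq p q
  have hd : 1 ≤ horizontalRadius (p - q) + |p.2.2 - q.2.2| := hpq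
  have hz : |p.2.2 - q.2.2| = horizontalRadius p - horizontalRadius q := by
    by_cases h : 0 ≤ p.2.2
    · rw [abs_of_nonneg h] at hp1
      rw [abs_of_nonneg (hside.1 h)] at hq1
      rw [abs_of_nonpos (by linarith)]
      linarith
    · have h' := mt hside.2 h
      rw [abs_of_neg (not_le.1 h)] at hp1
      rw [abs_of_neg (not_le.1 h')] at hq1
      rw [abs_of_nonneg (by linarith)]
      linarith
  have hr1 : horizontalRadius p ≤ 1 := by linarith [abs_nonneg p.2.2]
  rw [hz] at hd
  generalize Real.cos (horizontalArg p - horizontalArg q) = C at *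
  generalize horizontalRadius (p - q) = D at *
  generalize horizontalRadius p = r at *
  generalize horizontalRadius q = s at *
  have hD2 : (1 - (r - s)) ^ 2 ≤ D ^ 2 := pow_le_pow_left₀ (by linarith) (by linarith) 2
  have hr : 0 < r := by linarith
  have hs : 0 < s := by linarith
  have heq : 1 - 2 * (1 - (1 - 1 / (2 * r)) * (2 - (1 - 1 / (2 * s)))) =
      (2 * r * s - (1 - 2 * (r - s))) / (2 * r * s) := by
    field_simp
    ring
  rw [heq, le_div_iff₀ (by positivity)]
  nlinarith

theorem exists_radius_class {r : ℝ} (h1 : 1 / 2 ≤ r) (h2 : r ≤ 1) :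
    ∃ k < 6, (radiusBreaks k : ℝ) ≤ 1 - 1 / (2 * r) ∧ 1 - 1 / (2 * r) ≤ radiusBreaks (k + 1) := by
  have hlo : 0 ≤ 1 - 1 / (2 * r) := by
    rw [sub_nonneg, div_le_one (by linarith)]
    linarith
  have hhi : 1 - 1 / (2 * r) ≤ 1 / 2 := by
    have : 1 / 2 ≤ 1 / (2 * r) := one_div_le_one_div_of_le (by linarith) (by linarith)
    linarith
  generalize 1 - 1 / (2 * r) = c at *
  rcases le_total c (3 / 20) with h | h
  · exact ⟨0, by norm_num, by norm_num [radiusBreaks]; linarith,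
      by norm_num [radiusBreaks]; linarith⟩
  rcases le_total c (5 / 20) with h | h
  · exact ⟨1, by norm_num, by norm_num [radiusBreaks]; linarith,
      by norm_num [radiusBreaks]; linarith⟩
  rcases le_total c (7 / 20) with h | h
  · exact ⟨2, by norm_num, by norm_num [radiusBreaks]; linarith,
      by norm_num [radiusBreaks]; linarith⟩
  rcases le_total c (8 / 20) with h | h
  · exact ⟨3, by norm_num, by norm_num [radiusBreaks]; linarith,
      by norm_num [radiusBreaks]; linarith⟩
  rcases le_total c (9 / 20) with h | h
  · exact ⟨4, by norm_num, by norm_num [radiusBreaks]; linarith,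
      by norm_num [radiusBreaks]; linarith⟩
  · exact ⟨5, by norm_num, by norm_num [radiusBreaks]; linarith,
      by norm_num [radiusBreaks]; linarith⟩

/-- The point `p` has index `a` in the sense of `angleTable`. -/
def HasIndex (p : ℝ × ℝ × ℝ) (a : ℕ) : Prop :=
  ∃ k < 6, ∃ i < 2, a = 2 * k + i ∧ (0 ≤ p.2.2 ↔ i = 0) ∧
    (radiusBreaks k : ℝ) ≤ 1 - 1 / (2 * horizontalRadius p) ∧
    1 - 1 / (2 * horizontalRadius p) ≤ radiusBreaks (k + 1)

theorem exists_hasIndex {p : ℝ × ℝ × ℝ} (hp : p ∈ pettySphere) (hr : 1 / 2 ≤ horizontalRadius p) :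
    ∃ a < 12, HasIndex p a := by
  obtain ⟨k, hk, h1, h2⟩ := exists_radius_class hr
    (by linarith [horizontalRadius_add_abs hp, abs_nonneg p.2.2])
  by_cases h : 0 ≤ p.2.2
  · exact ⟨2 * k, by omega, k, hk, 0, by omega, rfl, by simpa using h, h1, h2⟩
  · exact ⟨2 * k + 1, by omega, k, hk, 1, by omega, rfl, by simpa using h, h1, h2⟩

theorem minAngle_le {p q : ℝ × ℝ × ℝ} (hp : p ∈ pettySphere) (hq : q ∈ pettySphere)
    (hpq : 1 ≤ pettyDist p q) (hqp : 1 ≤ pettyDist q p) (hrp : 1 / 2 ≤ horizontalRadius p)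
    (hrq : 1 / 2 ≤ horizontalRadius q) {a b : ℕ} (ha : HasIndex p a) (hb : HasIndex q b)
    {δ : ℝ} (hδ : 0 ≤ δ) (hcos : Real.cos δ = Real.cos (horizontalArg p - horizontalArg q)) :
    minAngle a b * (Real.pi / 180) ≤ δ := by
  obtain ⟨k, hk, i, hi, rfl, hip, hlp, hup⟩ := ha
  obtain ⟨l, hl, j, hj, rfl, hjq, hlq, huq⟩ := hb
  have hpos : ∀ k < 6, 0 ≤ radiusBreaks k ∧ radiusBreaks k ≤ 2 := by decide +kernel
  have hk0 : (0 : ℝ) ≤ radiusBreaks k := by exact_mod_cast (hpos k hk).1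
  have hl0 : (0 : ℝ) ≤ radiusBreaks l := by exact_mod_cast (hpos l hl).1
  have hk2 : (radiusBreaks k : ℝ) ≤ 2 := by exact_mod_cast (hpos k hk).2
  have hl2 : (radiusBreaks l : ℝ) ≤ 2 := by exact_mod_cast (hpos l hl).2
  by_cases hij : i = j
  · subst hij
    rcases le_total (horizontalRadius q) (horizontalRadius p) with hle | hle
    · refine degree_le_of_angleCheck (angleCheck_same_side k hk l hl i hi).1 hδ ?_
      have h := cos_le_of_same_side hp hq hpq hrp hrq (hip.trans hjq.symm) hle
      push_cast
      rw [hcos]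
      nlinarith [mul_nonneg (sub_nonneg.2 hlq) (hk0.trans hlp),
        mul_nonneg (sub_nonneg.2 hup) (sub_nonneg.2 hl2)]
    · refine degree_le_of_angleCheck (angleCheck_same_side k hk l hl i hi).2 hδ ?_
      have h := cos_le_of_same_side hq hp hqp hrq hrp (hjq.trans hip.symm) hle
      rw [← Real.cos_neg, neg_sub] at h
      push_cast
      rw [hcos]
      nlinarith [mul_nonneg (sub_nonneg.2 hlp) (hl0.trans hlq),
        mul_nonneg (sub_nonneg.2 huq) (sub_nonneg.2 hk2)]
  · refine degree_le_of_angleCheck (angleCheck_opposite_side k hk l hl i hi j hj hij) hδ ?_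
    have h := cos_le_of_one_le_pettyDist hp hq hpq hrp hrq
    push_cast
    rw [hcos]
    linarith [mul_le_mul hlp hlq hl0 (hk0.trans hlp)]

/-- Going around a circle through `N` points, starting at a suitable one of them, the `j`-th step
never leads further than `j` times the average gap. -/
theorem exists_slow_walk {N : ℕ} (hN : 0 < N) (θ : Fin N → ℝ) (hmono : Monotone θ)
    (hθ : ∀ i, θ i ∈ Set.Ioc (-Real.pi) Real.pi) :
    ∃ (idx : ℕ → Fin N) (t : ℕ → ℝ), t 0 = 0 ∧ Monotone t ∧
      (∀ j, t j ≤ 2 * Real.pi / N * j) ∧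
      (∀ i j, i < j → idx i = idx j → 2 * Real.pi ≤ t j - t i) ∧
      ∀ i j, Real.cos (t j - t i) = Real.cos (θ (idx i) - θ (idx j)) := by
  have hpi := Real.pi_pos
  have : Nonempty (Fin N) := ⟨⟨0, hN⟩⟩
  have hN' : (N : ℝ) ≠ 0 := by positivity
  obtain ⟨i₀, hi₀⟩ := Finite.exists_max fun i : Fin N => θ i - 2 * Real.pi / N * (i : ℕ)
  set idx : ℕ → Fin N := fun n => ⟨n % N, Nat.mod_lt n hN⟩ with hidx
  set T : ℕ → ℝ := fun n => θ (idx n) + 2 * Real.pi * (n / N : ℕ) with hT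
  have hTi₀ : T i₀ = θ i₀ := by
    have h : idx i₀ = i₀ := Fin.ext (Nat.mod_eq_of_lt i₀.2)
    simp [hT, h, Nat.div_eq_of_lt i₀.2]
  have hstep : ∀ i j, i / N + 1 ≤ j / N →
      θ (idx j) - θ (idx i) + 2 * Real.pi ≤ T j - T i := by
    intro i j hij
    have h : ((i / N : ℕ) : ℝ) + 1 ≤ (j / N : ℕ) := by exact_mod_cast hij
    simp only [hT]
    nlinarith
  have hTmono : Monotone T := by
    intro i j hij
    rcases (Nat.div_le_div_right (c := N) hij).eq_or_lt with h | h
    · have hmod : i % N ≤ j % N := by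
        have h1 := Nat.div_add_mod i N
        have h2 := Nat.div_add_mod j N
        rw [h] at h1
        omega
      simp only [hT, h]
      have := hmono (show idx i ≤ idx j from hmod)
      linarith
    · linarith [hstep i j h, (hθ (idx j)).1, (hθ (idx i)).2]
  refine ⟨fun n => idx (i₀ + n), fun n => T (i₀ + n) - T i₀, by simp, ?_, ?_, ?_, ?_⟩
  · intro i j hij
    exact sub_le_sub_right (hTmono (by omega)) _
  · intro j
    have h := hi₀ (idx (i₀ + j))
    have hdm : (N : ℝ) * ((i₀ + j) / N : ℕ) + ((i₀ + j) % N : ℕ) = i₀ + j := by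
      exact_mod_cast Nat.div_add_mod (i₀ + j) N
    have hval : ((idx (i₀ + j) : ℕ) : ℝ) = i₀ + j - N * ((i₀ + j) / N : ℕ) := by
      rw [← hdm]
      simp [hidx]
    rw [hval] at h
    have hcancel : 2 * Real.pi / N * (i₀ + j - N * ((i₀ + j) / N : ℕ)) =
        2 * Real.pi / N * i₀ + 2 * Real.pi / N * j - 2 * Real.pi * ((i₀ + j) / N : ℕ) := by
      field_simp
    rw [hTi₀]
    simp only [hT]
    linarith
  · intro i j hij h
    have hmod : (i₀ + i) % N = (i₀ + j) % N := congrArg Fin.val h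
    have h1 := Nat.div_add_mod (i₀ + i) N
    have h2 := Nat.div_add_mod (i₀ + j) N
    have hlt : (i₀ + i : ℕ) / N < (i₀ + j) / N := by
      by_contra! hle
      have := Nat.mul_le_mul_left N hle
      omega
    have h3 := hstep _ _ hlt
    have h4 : θ (idx (i₀ + i)) = θ (idx (i₀ + j)) := congrArg θ h
    simp only
    linarith
  · intro i j
    have h : T (i₀ + j) - T i₀ - (T (i₀ + i) - T i₀) =
        -(θ (idx (i₀ + i)) - θ (idx (i₀ + j))) +
          (((((i₀ + j) / N : ℕ) : ℤ) - (((i₀ + i) / N : ℕ) : ℤ) : ℤ) : ℝ) *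
            (2 * Real.pi) := by
      simp only [hT, Int.cast_sub, Int.cast_natCast]
      ring
    rw [h, Real.cos_add_int_mul_two_pi, Real.cos_neg]

theorem encard_belt_le {S : Set (ℝ × ℝ × ℝ)} (hsep : OneSeparated S) (hS : S ⊆ pettySphere)
    (hbelt : ∀ p ∈ S, 1 / 2 ≤ horizontalRadius p) : S.encard ≤ 14 := by
  by_contra! hlt
  obtain ⟨F, hFS, hF⟩ := Set.exists_subset_encard_eq (Order.add_one_le_of_lt hlt)
  have hfin : F.Finite := Set.finite_of_encard_eq_coe (k := 15) hF
  have hcard : hfin.toFinset.card = 15 := by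
    rw [hfin.encard_eq_coe_toFinset_card] at hF
    exact_mod_cast hF
  set f : Fin 15 → ℝ × ℝ × ℝ := fun i => (hfin.toFinset.equivFinOfCardEq hcard).symm i
  have hfinj : Function.Injective f :=
    Subtype.val_injective.comp (Equiv.injective _)
  have hfS : ∀ i, f i ∈ S := fun i =>
    hFS (hfin.mem_toFinset.1 ((hfin.toFinset.equivFinOfCardEq hcard).symm i).2)
  set σ := Tuple.sort (horizontalArg ∘ f)
  obtain ⟨idx, t, ht0, htmono, hslow, hlap, hcos⟩ := exists_slow_walk (by norm_num)
    ((horizontalArg ∘ f) ∘ σ) (Tuple.monotone_sort _) fun i => Complex.arg_mem_Ioc _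
  choose s hs12 hs using fun n => exists_hasIndex (hS (hfS (σ (idx n)))) (hbelt _ (hfS (σ (idx n))))
  have hpi := Real.pi_pos
  have hgap : ∀ i j, i < j → minAngle (s i) (s j) * (Real.pi / 180) ≤ t j - t i := by
    intro i j hij
    by_cases heq : idx i = idx j
    · have hbound : ∀ a < 12, ∀ b < 12, minAngle a b ≤ 360 := by decide
      have h360 : (minAngle (s i) (s j) : ℝ) ≤ 360 := by
        exact_mod_cast hbound _ (hs12 i) _ (hs12 j)
      nlinarith [hlap i j hij heq]
    · have hne : f (σ (idx i)) ≠ f (σ (idx j)) := fun h => heq (σ.injective (hfinj h))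
      exact minAngle_le (hS (hfS _)) (hS (hfS _)) (hsep _ (hfS _) _ (hfS _) hne)
        (hsep _ (hfS _) _ (hfS _) hne.symm) (hbelt _ (hfS _)) (hbelt _ (hfS _)) (hs i) (hs j)
        (sub_nonneg.2 (htmono hij.le)) (hcos i j)
  have hfalse := not_noPlacement s (fun j => t j * (180 / Real.pi)) hs12 ?_ ?_ 17 0
    (List.replicate 12 0) rfl ?_
  · rw [mul_zero, noPlacement_replicate] at hfalse
    cases hfalse
  · intro i j hij
    have h := mul_le_mul_of_nonneg_right (hgap i j hij) (show 0 ≤ 180 / Real.pi by positivity)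
    have hone : Real.pi / 180 * (180 / Real.pi) = 1 := by field_simp
    rw [mul_assoc, hone] at h
    linarith
  · intro j
    have h := mul_le_mul_of_nonneg_right (hslow j) (show 0 ≤ 180 / Real.pi by positivity)
    have hone : 2 * Real.pi / (15 : ℕ) * j * (180 / Real.pi) = 24 * j := by
      field_simp
      push_cast
      ring
    exact h.trans_eq hone
  · intro j _
    have hzero : (List.replicate 12 0).getD (s j) 0 = 0 := by
      rw [List.getD_eq_getElem _ _ (by simpa using hs12 j), List.getElem_replicate]
    rw [hzero, Nat.cast_zero]
    exact mul_nonneg (ht0 ▸ htmono (Nat.zero_le j)) (by positivity)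

theorem encard_cap_le_one {S : Set (ℝ × ℝ × ℝ)} (hsep : OneSeparated S) (hS : S ⊆ pettySphere)
    (hcap : ∀ p ∈ S, horizontalRadius p < 1 / 2)
    (hside : ∀ p ∈ S, ∀ q ∈ S, 0 ≤ p.2.2 * q.2.2) : S.encard ≤ 1 := by
  rw [Set.encard_le_one_iff]
  intro p q hp hq
  by_contra hne
  have hd : 1 ≤ horizontalRadius (p - q) + |p.2.2 - q.2.2| := hsep p hp q hq hne
  have hp1 := horizontalRadius_add_abs (hS hp)
  have hq1 := horizontalRadius_add_abs (hS hq)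
  have hp0 : 0 ≤ horizontalRadius p := Real.sqrt_nonneg _
  have hq0 : 0 ≤ horizontalRadius q := Real.sqrt_nonneg _
  have hsum : horizontalRadius (p - q) ≤ horizontalRadius p + horizontalRadius q := by
    refine le_of_sq_le_sq ?_ (by positivity)
    rw [horizontalRadius_sub_sq]
    nlinarith [Real.neg_one_le_cos (horizontalArg p - horizontalArg q), mul_nonneg hp0 hq0]
  have hz : |p.2.2 - q.2.2| = |horizontalRadius p - horizontalRadius q| := by
    rw [← sq_eq_sq₀ (abs_nonneg _) (abs_nonneg _), sq_abs, sq_abs]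
    have h1 : |p.2.2| * |q.2.2| = p.2.2 * q.2.2 := by
      rw [← abs_mul, abs_of_nonneg (hside p hp q hq)]
    have h2 : horizontalRadius p - horizontalRadius q = |q.2.2| - |p.2.2| := by linarith
    rw [h2]
    nlinarith [sq_abs p.2.2, sq_abs q.2.2]
  rw [hz] at hd
  rcases abs_cases (horizontalRadius p - horizontalRadius q) with h | h <;>
    linarith [hcap p hp, hcap q hq, h.1]

/-- every 1-separated subset of the Petty unit sphere has at most 16
elements; in particular the Hadwiger number of the Petty space is at most 16. -/
theorem oneSeparated_sphere_le_16 (S : Set (ℝ × ℝ × ℝ)) (hsep : OneSeparated S)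
    (hS : S ⊆ pettySphere) : S.encard ≤ 16 := by
  have restrict : ∀ P : ℝ × ℝ × ℝ → Prop, OneSeparated {p ∈ S | P p} ∧
      {p ∈ S | P p} ⊆ pettySphere := fun P =>
    ⟨fun a ha b hb hab => hsep a ha.1 b hb.1 hab, fun a ha => hS ha.1⟩
  have hbelt : {p ∈ S | 1 / 2 ≤ horizontalRadius p}.encard ≤ 14 :=
    encard_belt_le (restrict _).1 (restrict _).2 fun p hp => hp.2
  have hupper : {p ∈ S | horizontalRadius p < 1 / 2 ∧ 0 ≤ p.2.2}.encard ≤ 1 :=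
    encard_cap_le_one (restrict _).1 (restrict _).2 (fun p hp => hp.2.1)
      fun p hp q hq => mul_nonneg hp.2.2 hq.2.2
  have hlower : {p ∈ S | horizontalRadius p < 1 / 2 ∧ p.2.2 < 0}.encard ≤ 1 :=
    encard_cap_le_one (restrict _).1 (restrict _).2 (fun p hp => hp.2.1)
      fun p hp q hq => (mul_pos_of_neg_of_neg hp.2.2 hq.2.2).le
  have hcover : S ⊆ {p ∈ S | 1 / 2 ≤ horizontalRadius p} ∪
      ({p ∈ S | horizontalRadius p < 1 / 2 ∧ 0 ≤ p.2.2} ∪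
        {p ∈ S | horizontalRadius p < 1 / 2 ∧ p.2.2 < 0}) := by
    intro p hp
    rcases le_or_gt (1 / 2) (horizontalRadius p) with h | h
    · exact Or.inl ⟨hp, h⟩
    · rcases le_or_gt 0 p.2.2 with h' | h'
      · exact Or.inr (Or.inl ⟨hp, h, h'⟩)
      · exact Or.inr (Or.inr ⟨hp, h, h'⟩)
  calc S.encard ≤ _ := Set.encard_le_encard hcover
    _ ≤ _ := Set.encard_union_le _ _
    _ ≤ 14 + (1 + 1) :=
      add_le_add hbelt ((Set.encard_union_le _ _).trans (add_le_add hupper hlower))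
    _ = 16 := by norm_num
end
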